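/- The function p ↦ γ_p = ∫₀^∞ log x dν_{α(p)}(x), where α(p) = (3p − 2 + √(5p² − 8p + 4))/(2p), is strictly increasing on (0,1]. Consequently, the function α ↦ ∫₀^∞ log x dν_α(x) is strictly increasing on (1/2, 1]. -/

import Mathlib

open MeasureTheory Filter Set Topology

noncomputable section

/-- Endpoints (as pairs of nonnegative integers, `(a,b)` representing `a/b`, with `1/0 = ∞`)
of the Stern-Brocot interval obtained from `[0/1, 1/0]` by following the list of choices `w`
(`true` = left sub-interval, `false` = right sub-interval). -/
def sbGo : (ℕ × ℕ) × (ℕ × ℕ) → List Bool → (ℕ × ℕ) × (ℕ × ℕ)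
  | I, [] => I
  | ((a, b), (c, d)), (lft :: w) =>
      if lft then sbGo ((a, b), (a + c, b + d)) w else sbGo ((a + c, b + d), (c, d)) w

/-- The Stern-Brocot interval of rank `w.length` indexed by the list of choices `w`. -/
def sb (w : List Bool) : (ℕ × ℕ) × (ℕ × ℕ) := sbGo ((0, 1), (1, 0)) w

/-- The intersection of a Stern-Brocot interval with `[0, ∞)`, as a subset of `ℝ`. -/
def sbSet : (ℕ × ℕ) × (ℕ × ℕ) → Set ℝ
  | ((a, b), (c, d)) =>
      if d = 0 then Set.Ici ((a : ℝ) / (b : ℝ))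
      else Set.Icc ((a : ℝ) / (b : ℝ)) ((c : ℝ) / (d : ℝ))

/-- `ν` is the measure `ν_α`: a Borel probability measure on `[0,∞)` (viewed as a measure on `ℝ`
giving no mass to `(-∞,0)`) with `ν([0,1]) = 1 - α`, `ν([1,∞)) = α`, and such that for every
Stern-Brocot interval `I` of rank `r ≥ 1`, the left sub-interval of `I` carries a proportion `α`
of the mass of `I` if `r` is odd and `1 - α` if `r` is even. -/
def IsSternBrocotMeasure (α : ℝ) (ν : Measure ℝ) : Prop :=
  IsProbabilityMeasure ν ∧
  ν (Set.Iio 0) = 0 ∧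
  ν (Set.Icc 0 1) = ENNReal.ofReal (1 - α) ∧
  ν (Set.Ici 1) = ENNReal.ofReal α ∧
  ∀ w : List Bool, 1 ≤ w.length →
    ν (sbSet (sb (w ++ [true]))) =
      (if Odd w.length then ENNReal.ofReal α else ENNReal.ofReal (1 - α)) * ν (sbSet (sb w))

/-- The region `a/b ≤ x ≤ c/d`, written without divisions. -/
def sbRegion (J : (ℕ × ℕ) × (ℕ × ℕ)) : Set ℝ :=
  {x | (J.1.1 : ℝ) ≤ J.1.2 * x ∧ (J.2.2 : ℝ) * x ≤ J.2.1}

lemma sbSet_eq_sbRegion {J : (ℕ × ℕ) × (ℕ × ℕ)} (hb : 0 < J.1.2) :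
    sbSet J = sbRegion J := by
  obtain ⟨⟨a, b⟩, c, d⟩ := J
  have hb' : (0 : ℝ) < b := by exact_mod_cast hb
  ext x
  rcases Nat.eq_zero_or_pos d with rfl | hd
  · simp [sbSet, sbRegion, div_le_iff₀ hb', mul_comm]
  · have hd' : (0 : ℝ) < d := by exact_mod_cast hd
    simp [sbSet, sbRegion, hd.ne', div_le_iff₀ hb', le_div_iff₀ hd', mul_comm]

lemma sbGo_append (J : (ℕ × ℕ) × (ℕ × ℕ)) (v w : List Bool) :
    sbGo J (v ++ w) = sbGo (sbGo J v) w := by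
  induction v generalizing J with
  | nil => simp [sbGo]
  | cons t v ih =>
    obtain ⟨⟨a, b⟩, c, d⟩ := J
    cases t <;> simp [sbGo, ih]

lemma sbGo_pos {J : (ℕ × ℕ) × (ℕ × ℕ)} (hb : 0 < J.1.2) (hc : 0 < J.2.1) (w : List Bool) :
    0 < (sbGo J w).1.2 ∧ 0 < (sbGo J w).2.1 := by
  induction w generalizing J with
  | nil => exact ⟨hb, hc⟩
  | cons t w ih =>
    obtain ⟨⟨a, b⟩, c, d⟩ := J
    simp only at hb hc
    cases t
    · simpa [sbGo] using ih (J := ((a + c, b + d), (c, d))) (by simp; omega) (by simpa)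
    · simpa [sbGo] using ih (J := ((a, b), (a + c, b + d))) (by simpa) (by simp; omega)

lemma sb_pos (w : List Bool) : 0 < (sb w).1.2 ∧ 0 < (sb w).2.1 :=
  sbGo_pos (by simp) (by simp) w

lemma sbGo_endpoints_le {J : (ℕ × ℕ) × (ℕ × ℕ)} (hJ : J.1.1 * J.2.2 ≤ J.2.1 * J.1.2)
    (w : List Bool) :
    (sbGo J w).1.1 * (sbGo J w).2.2 ≤ (sbGo J w).2.1 * (sbGo J w).1.2 := by
  induction w generalizing J with
  | nil => exact hJ
  | cons t w ih =>
    obtain ⟨⟨a, b⟩, c, d⟩ := J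
    simp only at hJ
    cases t
    · simpa [sbGo] using ih (J := ((a + c, b + d), (c, d))) (by simp only; nlinarith)
    · simpa [sbGo] using ih (J := ((a, b), (a + c, b + d))) (by simp only; nlinarith)

lemma sb_endpoints_le (w : List Bool) :
    (sb w).1.1 * (sb w).2.2 ≤ (sb w).2.1 * (sb w).1.2 :=
  sbGo_endpoints_le (by simp) w

lemma sbSet_sb (w : List Bool) : sbSet (sb w) = sbRegion (sb w) :=
  sbSet_eq_sbRegion (sb_pos w).1

lemma sb_append_true (w : List Bool) :
    sb (w ++ [true]) = ((sb w).1, ((sb w).1.1 + (sb w).2.1, (sb w).1.2 + (sb w).2.2)) := by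
  simp [sb, sbGo_append, sbGo]

lemma sb_append_false (w : List Bool) :
    sb (w ++ [false]) = (((sb w).1.1 + (sb w).2.1, (sb w).1.2 + (sb w).2.2), (sb w).2) := by
  simp [sb, sbGo_append, sbGo]

lemma isClosed_sbRegion (J : (ℕ × ℕ) × (ℕ × ℕ)) : IsClosed (sbRegion J) := by
  have h1 : IsClosed {x : ℝ | (J.1.1 : ℝ) ≤ J.1.2 * x} := isClosed_le (by fun_prop) (by fun_prop)
  have h2 : IsClosed {x : ℝ | (J.2.2 : ℝ) * x ≤ J.2.1} := isClosed_le (by fun_prop) (by fun_prop)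
  exact h1.inter h2

lemma mem_sbSet_sb {w : List Bool} {x : ℝ} : x ∈ sbSet (sb w) ↔
    ((sb w).1.1 : ℝ) ≤ (sb w).1.2 * x ∧ ((sb w).2.2 : ℝ) * x ≤ (sb w).2.1 := by
  rw [sbSet_sb]; rfl

lemma mem_sbSet_append_true {w : List Bool} {x : ℝ} : x ∈ sbSet (sb (w ++ [true])) ↔
    ((sb w).1.1 : ℝ) ≤ (sb w).1.2 * x ∧
      ((sb w).1.2 + (sb w).2.2 : ℝ) * x ≤ (sb w).1.1 + (sb w).2.1 := by
  rw [mem_sbSet_sb, sb_append_true]; push_cast; rfl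

lemma mem_sbSet_append_false {w : List Bool} {x : ℝ} : x ∈ sbSet (sb (w ++ [false])) ↔
    ((sb w).1.1 + (sb w).2.1 : ℝ) ≤ ((sb w).1.2 + (sb w).2.2) * x ∧
      ((sb w).2.2 : ℝ) * x ≤ (sb w).2.1 := by
  rw [mem_sbSet_sb, sb_append_false]; push_cast; rfl

lemma measurableSet_sbSet_sb (w : List Bool) : MeasurableSet (sbSet (sb w)) := by
  rw [sbSet_sb]; exact (isClosed_sbRegion _).measurableSet

lemma sbSet_append_union (w : List Bool) :
    sbSet (sb (w ++ [true])) ∪ sbSet (sb (w ++ [false])) = sbSet (sb w) := by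
  ext x
  rw [mem_union, mem_sbSet_append_true, mem_sbSet_append_false, mem_sbSet_sb]
  constructor
  · rintro (⟨h1, h2⟩ | ⟨h1, h2⟩) <;> constructor <;> linarith
  · rintro ⟨h1, h2⟩
    rcases le_total (((sb w).1.2 + (sb w).2.2 : ℝ) * x) ((sb w).1.1 + (sb w).2.1) with h | h
    · exact Or.inl ⟨h1, h⟩
    · exact Or.inr ⟨h, h2⟩

lemma sbSet_append_inter (w : List Bool) :
    sbSet (sb (w ++ [true])) ∩ sbSet (sb (w ++ [false])) ⊆
      {((sb (w ++ [false])).1.1 : ℝ) / (sb (w ++ [false])).1.2} := by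
  have hpos : (0 : ℝ) < (sb (w ++ [false])).1.2 := by exact_mod_cast (sb_pos _).1
  rintro x ⟨h1, h2⟩
  rw [mem_sbSet_append_true] at h1
  rw [mem_sbSet_append_false] at h2
  rw [mem_singleton_iff, eq_div_iff hpos.ne', sb_append_false]
  push_cast
  linarith [h1.2, h2.1]

lemma sbSet_sb_nil : sbSet (sb []) = Ici 0 := by simp [sb, sbGo, sbSet]

lemma sbSet_sb_true : sbSet (sb [true]) = Icc 0 1 := by simp [sb, sbGo, sbSet]

lemma sbSet_sb_false : sbSet (sb [false]) = Ici 1 := by simp [sb, sbGo, sbSet]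

/-- The mass which `ν_α` gives to the Stern-Brocot interval of a word. -/
def wordMass : ℝ → List Bool → ℝ
  | _, [] => 1
  | α, true :: w => (1 - α) * wordMass (1 - α) w
  | α, false :: w => α * wordMass (1 - α) w

lemma wordMass_map_not (α : ℝ) (w : List Bool) :
    wordMass α (w.map not) = wordMass (1 - α) w := by
  induction w generalizing α with
  | nil => simp [wordMass]
  | cons t w ih => cases t <;> simp [wordMass, ih]

lemma wordMass_append_true (α : ℝ) (w : List Bool) :
    wordMass α (w ++ [true]) = (if Odd w.length then α else 1 - α) * wordMass α w := by
  induction w generalizing α with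
  | nil => simp [wordMass]
  | cons t w ih =>
    cases t <;> by_cases h : Odd w.length <;> simp [wordMass, ih, Nat.odd_add_one, h] <;> ring

lemma wordMass_append_false (α : ℝ) (w : List Bool) :
    wordMass α (w ++ [false]) = (if Odd w.length then 1 - α else α) * wordMass α w := by
  induction w generalizing α with
  | nil => simp [wordMass]
  | cons t w ih =>
    cases t <;> by_cases h : Odd w.length <;> simp [wordMass, ih, Nat.odd_add_one, h] <;> ring

section Mass

variable {α : ℝ} {ν : Measure ℝ}

lemma IsSternBrocotMeasure.real_append_true (hα : α ∈ Icc (0 : ℝ) 1)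
    (h : IsSternBrocotMeasure α ν) {w : List Bool} (hw : 1 ≤ w.length) :
    ν.real (sbSet (sb (w ++ [true]))) =
      (if Odd w.length then α else 1 - α) * ν.real (sbSet (sb w)) := by
  rw [Measure.real, h.2.2.2.2 w hw, ENNReal.toReal_mul, ← Measure.real]
  split_ifs
  · rw [ENNReal.toReal_ofReal hα.1]
  · rw [ENNReal.toReal_ofReal (by linarith [hα.2])]

lemma IsSternBrocotMeasure.left_endpoint_null (hα : α ∈ Icc (0 : ℝ) 1)
    (h : IsSternBrocotMeasure α ν) {w : List Bool} (hw : 1 ≤ w.length) :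
    ν {((sb w).1.1 : ℝ) / (sb w).1.2} = 0 := by
  have : IsProbabilityMeasure ν := h.1
  have mem (v : List Bool) : ((sb v).1.1 : ℝ) / (sb v).1.2 ∈ sbSet (sb v) := by
    have hb : (0 : ℝ) < (sb v).1.2 := by exact_mod_cast (sb_pos v).1
    have hk : ((sb v).1.1 : ℝ) * (sb v).2.2 ≤ (sb v).2.1 * (sb v).1.2 := by
      exact_mod_cast sb_endpoints_le v
    rw [sbSet_sb]
    refine ⟨(mul_div_cancel₀ _ hb.ne').ge, ?_⟩
    rw [← mul_div_assoc, div_le_iff₀ hb]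
    linarith
  have key (k : ℕ) : ∀ v : List Bool, 1 ≤ v.length →
      ν.real {((sb v).1.1 : ℝ) / (sb v).1.2} ≤ (1 / 4) ^ k * ν.real (sbSet (sb v)) := by
    induction k with
    | zero =>
      intro v _
      simpa using measureReal_mono (singleton_subset_iff.2 (mem v))
    | succ k ih =>
      intro v hv
      have h1 := ih (v ++ [true] ++ [true]) (by simp)
      rw [h.real_append_true hα (by simp), h.real_append_true hα hv,
        show (sb (v ++ [true] ++ [true])).1 = (sb v).1 by simp only [sb_append_true]] at h1
      refine h1.trans ?_
      rw [pow_succ, mul_assoc]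
      refine mul_le_mul_of_nonneg_left ?_ (by positivity)
      have h0 : (0 : ℝ) ≤ ν.real (sbSet (sb v)) := measureReal_nonneg
      have hq : α * (1 - α) ≤ 1 / 4 := by nlinarith [sq_nonneg (2 * α - 1)]
      by_cases ho : Odd v.length <;> simp [ho, Nat.odd_add_one] <;> nlinarith
  have hlim : Tendsto (fun k : ℕ => (1 / 4 : ℝ) ^ k * ν.real (sbSet (sb w))) atTop (𝓝 0) := by
    simpa using (tendsto_pow_atTop_nhds_zero_of_lt_one (r := (1 / 4 : ℝ))
      (by norm_num) (by norm_num)).mul_const (ν.real (sbSet (sb w)))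
  have hle := ge_of_tendsto' hlim (fun k => key k w hw)
  exact (measureReal_eq_zero_iff).1 (le_antisymm hle measureReal_nonneg)

lemma IsSternBrocotMeasure.real_children (hα : α ∈ Icc (0 : ℝ) 1)
    (h : IsSternBrocotMeasure α ν) (w : List Bool) :
    ν.real (sbSet (sb (w ++ [true]))) + ν.real (sbSet (sb (w ++ [false]))) =
      ν.real (sbSet (sb w)) := by
  have : IsProbabilityMeasure ν := h.1
  have hnull := measure_mono_null (sbSet_append_inter w)
    (h.left_endpoint_null hα (w := w ++ [false]) (by simp))
  rw [← sbSet_append_union w,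
    ← measureReal_union_add_inter (measurableSet_sbSet_sb _)]
  simp [Measure.real, hnull]

lemma IsSternBrocotMeasure.real_sbSet (hα : α ∈ Icc (0 : ℝ) 1)
    (h : IsSternBrocotMeasure α ν) (w : List Bool) :
    ν.real (sbSet (sb w)) = wordMass α w := by
  have : IsProbabilityMeasure ν := h.1
  have h1 : ν.real (sbSet (sb [true])) = 1 - α := by
    rw [sbSet_sb_true, Measure.real, h.2.2.1, ENNReal.toReal_ofReal (by linarith [hα.2])]
  have h2 : ν.real (sbSet (sb [false])) = α := by
    rw [sbSet_sb_false, Measure.real, h.2.2.2.1, ENNReal.toReal_ofReal hα.1]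
  have h3 := h.real_children hα []
  simp only [List.nil_append, h1, h2] at h3
  induction w using List.reverseRecOn with
  | nil => simp only [wordMass]; linarith
  | append_singleton w t ih =>
    have h4 := h.real_children hα w
    have h5 : ν.real (sbSet (sb (w ++ [true]))) = wordMass α (w ++ [true]) := by
      rcases Nat.eq_zero_or_pos w.length with hw | hw
      · obtain rfl := List.length_eq_zero_iff.1 hw
        simpa [wordMass] using h1
      · rw [h.real_append_true hα hw, wordMass_append_true, ih]
    cases t
    · rw [h5, ih, wordMass_append_true] at h4
      rw [wordMass_append_false]
      split_ifs at h4 ⊢ <;> linarith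
    · exact h5

lemma IsSternBrocotMeasure.ae_pos (hα : α ∈ Icc (0 : ℝ) 1)
    (h : IsSternBrocotMeasure α ν) : ∀ᵐ x ∂ν, 0 < x := by
  have h1 := h.left_endpoint_null hα (w := [true]) (by simp)
  have h2 := measure_union_null h.2.1 h1
  rw [ae_iff]
  refine measure_mono_null (fun x hx => ?_) h2
  simp only [mem_ofPred_eq, not_lt] at hx
  rcases hx.lt_or_eq with hx | hx
  · exact Or.inl hx
  · right; simp [sb, sbGo, hx]

end Mass

/-- Euclid's algorithm: a measure is determined on `I ∩ [q, ∞)` by the masses of the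
Stern-Brocot sub-intervals of `I`. -/
lemma real_inter_Ici_eq {μ ν : Measure ℝ} [IsFiniteMeasure μ] [IsFiniteMeasure ν]
    (hμν : ∀ w, μ.real (sbSet (sb w)) = ν.real (sbSet (sb w)))
    (hν : ∀ w, ν.real (sbSet (sb (w ++ [true]))) + ν.real (sbSet (sb (w ++ [false]))) =
      ν.real (sbSet (sb w))) (N : ℕ) :
    ∀ (s t : ℕ) (w : List Bool) (q : ℝ), s + t ≤ N → 0 < s → 0 < t →
      ((s * (sb w).1.2 + t * (sb w).2.2 : ℕ) : ℝ) * q = (s * (sb w).1.1 + t * (sb w).2.1 : ℕ) →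
      μ.real (sbSet (sb w) ∩ Ici q) = ν.real (sbSet (sb w) ∩ Ici q) := by
  induction N with
  | zero => intro s t w q h1 h2; omega
  | succ N ih =>
    intro s t w q hst hs ht hq
    have inull {ρ : Measure ℝ} [IsFiniteMeasure ρ]
        (hρ : ρ.real (sbSet (sb (w ++ [true]))) + ρ.real (sbSet (sb (w ++ [false]))) =
          ρ.real (sbSet (sb w))) :
        ρ.real (sbSet (sb (w ++ [true])) ∩ sbSet (sb (w ++ [false]))) = 0 := by
      have := measureReal_union_add_inter (μ := ρ) (s := sbSet (sb (w ++ [true])))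
        (measurableSet_sbSet_sb (w ++ [false]))
      rw [sbSet_append_union] at this
      linarith
    have split {ρ : Measure ℝ} [IsFiniteMeasure ρ]
        (hρ : ρ.real (sbSet (sb (w ++ [true]))) + ρ.real (sbSet (sb (w ++ [false]))) =
          ρ.real (sbSet (sb w))) :
        ρ.real (sbSet (sb w) ∩ Ici q) = ρ.real (sbSet (sb (w ++ [true])) ∩ Ici q) +
          ρ.real (sbSet (sb (w ++ [false])) ∩ Ici q) := by
      have h1 := measureReal_union_add_inter (μ := ρ) (s := sbSet (sb (w ++ [true])) ∩ Ici q)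
        ((measurableSet_sbSet_sb (w ++ [false])).inter (measurableSet_Ici (a := q)))
      have h2 : ρ.real (sbSet (sb (w ++ [true])) ∩ Ici q ∩
          (sbSet (sb (w ++ [false])) ∩ Ici q)) = 0 :=
        le_antisymm ((measureReal_mono (by intro x hx; exact ⟨hx.1.1, hx.2.1⟩)).trans
          (inull hρ).le) measureReal_nonneg
      rw [← union_inter_distrib_right, sbSet_append_union, h2] at h1
      linarith
    have hμw : μ.real (sbSet (sb (w ++ [true]))) + μ.real (sbSet (sb (w ++ [false]))) =
        μ.real (sbSet (sb w)) := by rw [hμν, hμν, hμν, hν]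
    push_cast at hq
    have hb : (0 : ℝ) < (sb w).1.2 := by exact_mod_cast (sb_pos w).1
    have hS : (0 : ℝ) < s * (sb w).1.2 + t * (sb w).2.2 := by positivity
    have hk : ((sb w).1.1 : ℝ) * (sb w).2.2 ≤ (sb w).2.1 * (sb w).1.2 := by
      exact_mod_cast sb_endpoints_le w
    have hmid : (s * (sb w).1.2 + t * (sb w).2.2 : ℝ) *
        (((sb w).1.2 + (sb w).2.2 : ℝ) * q - ((sb w).1.1 + (sb w).2.1)) =
        ((t : ℝ) - s) * ((sb w).2.1 * (sb w).1.2 - (sb w).1.1 * (sb w).2.2) := by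
      linear_combination ((sb w).1.2 + (sb w).2.2 : ℝ) * hq
    rw [split hμw, split (hν w)]
    have left_eq (hst : s ≤ t) : μ.real (sbSet (sb (w ++ [true])) ∩ Ici q) =
        ν.real (sbSet (sb (w ++ [true])) ∩ Ici q) := by
      have hst' : (s : ℝ) ≤ t := by exact_mod_cast hst
      have hq' : 0 ≤ ((sb w).1.2 + (sb w).2.2 : ℝ) * q - ((sb w).1.1 + (sb w).2.1) := by
        refine nonneg_of_mul_nonneg_right (a := (s * (sb w).1.2 + t * (sb w).2.2 : ℝ)) ?_ hS
        rw [hmid]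
        exact mul_nonneg (by linarith) (by linarith)
      have hsub : sbSet (sb (w ++ [true])) ∩ Ici q ⊆
          sbSet (sb (w ++ [true])) ∩ sbSet (sb (w ++ [false])) := by
        rintro x ⟨hx, hqx : q ≤ x⟩
        refine ⟨hx, ?_⟩
        rw [mem_sbSet_append_true] at hx
        rw [mem_sbSet_append_false]
        have hmul : ((sb w).1.2 + (sb w).2.2 : ℝ) * q ≤ ((sb w).1.2 + (sb w).2.2) * x := by gcongr
        exact ⟨by linarith, by linarith⟩
      rw [le_antisymm ((measureReal_mono hsub).trans (inull hμw).le) measureReal_nonneg,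
        le_antisymm ((measureReal_mono hsub).trans (inull (hν w)).le) measureReal_nonneg]
    have right_eq (hst : t ≤ s) : μ.real (sbSet (sb (w ++ [false])) ∩ Ici q) =
        ν.real (sbSet (sb (w ++ [false])) ∩ Ici q) := by
      have hst' : (t : ℝ) ≤ s := by exact_mod_cast hst
      have hq' : ((sb w).1.2 + (sb w).2.2 : ℝ) * q - ((sb w).1.1 + (sb w).2.1) ≤ 0 := by
        refine nonpos_of_mul_nonpos_right (a := (s * (sb w).1.2 + t * (sb w).2.2 : ℝ)) ?_ hS
        rw [hmid]
        exact mul_nonpos_of_nonpos_of_nonneg (by linarith) (by linarith)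
      have hsub : sbSet (sb (w ++ [false])) ⊆ Ici q := by
        intro x hx
        rw [mem_sbSet_append_false] at hx
        exact le_of_mul_le_mul_left (a := ((sb w).1.2 + (sb w).2.2 : ℝ)) (by linarith)
          (by positivity)
      rw [inter_eq_left.2 hsub, hμν]
    rcases lt_trichotomy s t with hlt | heq | hgt
    · obtain ⟨r, rfl⟩ := Nat.exists_eq_add_of_lt hlt
      rw [left_eq hlt.le, ih s (r + 1) (w ++ [false]) q (by omega) hs (by omega) (by
        rw [sb_append_false]; push_cast at hq ⊢; linarith)]
    · rw [left_eq heq.le, right_eq heq.ge]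
    · obtain ⟨r, rfl⟩ := Nat.exists_eq_add_of_lt hgt
      rw [right_eq hgt.le, ih (r + 1) t (w ++ [true]) q (by omega) (by omega) ht (by
        rw [sb_append_true]; push_cast at hq ⊢; linarith)]

lemma measure_ext_of_sbSet {μ ν : Measure ℝ} [IsFiniteMeasure μ] [IsFiniteMeasure ν]
    (hμν : ∀ w, μ.real (sbSet (sb w)) = ν.real (sbSet (sb w)))
    (hν : ∀ w, ν.real (sbSet (sb (w ++ [true]))) + ν.real (sbSet (sb (w ++ [false]))) =
      ν.real (sbSet (sb w)))
    (hμ0 : μ (Iio 0) = 0) (hν0 : ν (Iio 0) = 0) : μ = ν := by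
  have hIci (q : ℝ) (hq : q ≤ 0) {ρ : Measure ℝ} (hρ : ρ (Iio 0) = 0) :
      ρ (Ici q) = ρ (Ici 0) := by
    refine le_antisymm ?_ (measure_mono (Ici_subset_Ici.2 hq))
    calc ρ (Ici q) ≤ ρ (Iio 0 ∪ Ici 0) := measure_mono (by simp)
      _ ≤ ρ (Iio 0) + ρ (Ici 0) := measure_union_le _ _
      _ = ρ (Ici 0) := by rw [hρ, zero_add]
  have hnil := hμν []
  rw [sbSet_sb_nil, Measure.real, Measure.real,
    ENNReal.toReal_eq_toReal_iff' (measure_ne_top _ _) (measure_ne_top _ _)] at hnil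
  have huniv {ρ : Measure ℝ} (hρ : ρ (Iio 0) = 0) : ρ univ = ρ (Ici 0) := by
    have : Ici (0 : ℝ) =ᵐ[ρ] univ := by
      rw [ae_eq_univ, compl_Ici]; exact hρ
    exact (measure_congr this).symm
  refine ext_of_generate_finite _ Real.borel_eq_generateFrom_Ici_rat Real.isPiSystem_Ici_rat ?_
    (by rw [huniv hμ0, huniv hν0, hnil])
  intro S hS
  obtain ⟨q, rfl⟩ := by simpa using hS
  rcases le_or_gt q 0 with hq | hq
  · have hq' : (q : ℝ) ≤ 0 := by exact_mod_cast hq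
    rw [hIci q hq' hμ0, hIci q hq' hν0, hnil]
  · have hnum : 0 < q.num := Rat.num_pos.2 hq
    have key := real_inter_Ici_eq hμν hν (q.den + q.num.toNat) q.den q.num.toNat [] q le_rfl
      q.den_pos (by omega) (by
        have h1 : ((q.num.toNat : ℕ) : ℝ) = (q.num : ℝ) := by
          exact_mod_cast Int.toNat_of_nonneg hnum.le
        have h2 : (q.den : ℝ) * (q : ℝ) = (q.num : ℝ) := by
          exact_mod_cast Rat.den_mul_eq_num q
        simp [sb, sbGo, h1, h2])
    have hq' : (0 : ℝ) ≤ q := by exact_mod_cast hq.le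
    rw [sbSet_sb_nil, inter_eq_right.2 (Ici_subset_Ici.2 hq'), Measure.real, Measure.real,
      ENNReal.toReal_eq_toReal_iff' (measure_ne_top _ _) (measure_ne_top _ _)] at key
    exact key

/-- The orientation-reversing bijection from `[0, ∞]` onto `[1, ∞]`. -/
def sbUp (x : ℝ) : ℝ := 1 + x⁻¹

/-- The orientation-reversing bijection from `[0, ∞]` onto `[0, 1]`. -/
def sbDown (x : ℝ) : ℝ := (1 + x)⁻¹

lemma measurable_sbUp : Measurable sbUp := by unfold sbUp; fun_prop

lemma measurable_sbDown : Measurable sbDown := by unfold sbDown; fun_prop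

lemma one_lt_sbUp {x : ℝ} (hx : 0 < x) : 1 < sbUp x := by
  have := inv_pos.2 hx
  unfold sbUp; linarith

lemma sbDown_pos {x : ℝ} (hx : 0 < x) : 0 < sbDown x := by unfold sbDown; positivity

lemma sbDown_lt_one {x : ℝ} (hx : 0 < x) : sbDown x < 1 :=
  inv_lt_one_of_one_lt₀ (by linarith)

lemma antitoneOn_sbUp : AntitoneOn sbUp (Ioi 0) := by
  intro x hx y hy hxy
  simp only [mem_Ioi] at hx hy
  unfold sbUp; gcongr

lemma antitoneOn_sbDown : AntitoneOn sbDown (Ioi 0) := by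
  intro x hx y hy hxy
  simp only [mem_Ioi] at hx hy
  unfold sbDown; gcongr

lemma sbGo_map_not_up (J : (ℕ × ℕ) × (ℕ × ℕ)) (w : List Bool) :
    sbGo ((J.2.1 + J.2.2, J.2.1), (J.1.1 + J.1.2, J.1.1)) w =
      (((sbGo J (w.map not)).2.1 + (sbGo J (w.map not)).2.2, (sbGo J (w.map not)).2.1),
        ((sbGo J (w.map not)).1.1 + (sbGo J (w.map not)).1.2, (sbGo J (w.map not)).1.1)) := by
  induction w generalizing J with
  | nil => simp [sbGo]
  | cons t w ih =>
    obtain ⟨⟨a, b⟩, c, d⟩ := J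
    cases t
    · simpa [sbGo, add_comm, add_left_comm, add_assoc] using ih ((a, b), (a + c, b + d))
    · simpa [sbGo, add_comm, add_left_comm, add_assoc] using ih ((a + c, b + d), (c, d))

lemma sbGo_map_not_down (J : (ℕ × ℕ) × (ℕ × ℕ)) (w : List Bool) :
    sbGo ((J.2.2, J.2.1 + J.2.2), (J.1.2, J.1.1 + J.1.2)) w =
      (((sbGo J (w.map not)).2.2, (sbGo J (w.map not)).2.1 + (sbGo J (w.map not)).2.2),
        ((sbGo J (w.map not)).1.2, (sbGo J (w.map not)).1.1 + (sbGo J (w.map not)).1.2)) := by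
  induction w generalizing J with
  | nil => simp [sbGo]
  | cons t w ih =>
    obtain ⟨⟨a, b⟩, c, d⟩ := J
    cases t
    · simpa [sbGo, add_comm, add_left_comm, add_assoc] using ih ((a, b), (a + c, b + d))
    · simpa [sbGo, add_comm, add_left_comm, add_assoc] using ih ((a + c, b + d), (c, d))

lemma sb_false_cons (w : List Bool) :
    sb (false :: w) = (((sb (w.map not)).2.1 + (sb (w.map not)).2.2, (sb (w.map not)).2.1),
      ((sb (w.map not)).1.1 + (sb (w.map not)).1.2, (sb (w.map not)).1.1)) := by
  simpa [sb, sbGo] using sbGo_map_not_up ((0, 1), (1, 0)) w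

lemma sb_true_cons (w : List Bool) :
    sb (true :: w) = (((sb (w.map not)).2.2, (sb (w.map not)).2.1 + (sb (w.map not)).2.2),
      ((sb (w.map not)).1.2, (sb (w.map not)).1.1 + (sb (w.map not)).1.2)) := by
  simpa [sb, sbGo] using sbGo_map_not_down ((0, 1), (1, 0)) w

lemma sbUp_mem_false_cons {w : List Bool} {x : ℝ} (hx : 0 < x) :
    sbUp x ∈ sbSet (sb (false :: w)) ↔ x ∈ sbSet (sb (w.map not)) := by
  rw [mem_sbSet_sb, mem_sbSet_sb, sb_false_cons]
  generalize sb (w.map not) = J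
  have h (u : ℝ) : u * sbUp x = (u * x + u) / x := by unfold sbUp; field_simp
  push_cast
  rw [h, h, le_div_iff₀ hx, div_le_iff₀ hx]
  constructor <;> rintro ⟨h1, h2⟩ <;> constructor <;> linarith

lemma sbDown_mem_true_cons {w : List Bool} {x : ℝ} (hx : 0 < x) :
    sbDown x ∈ sbSet (sb (true :: w)) ↔ x ∈ sbSet (sb (w.map not)) := by
  rw [mem_sbSet_sb, mem_sbSet_sb, sb_true_cons]
  generalize sb (w.map not) = J
  have hx1 : 0 < 1 + x := by linarith
  have h (u : ℝ) : u * sbDown x = u / (1 + x) := rfl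
  push_cast
  rw [h, h, le_div_iff₀ hx1, div_le_iff₀ hx1]
  constructor <;> rintro ⟨h1, h2⟩ <;> constructor <;> linarith

lemma sbSet_false_cons_subset (w : List Bool) : sbSet (sb (false :: w)) ⊆ Ici 1 := by
  intro x hx
  have hpos := (sb_pos (false :: w)).1
  rw [mem_sbSet_sb] at hx
  have h1 := hx.1
  rw [sb_false_cons] at h1 hpos
  push_cast at h1
  have hc : (0 : ℝ) < (sb (w.map not)).2.1 := by exact_mod_cast hpos
  have hd : (0 : ℝ) ≤ (sb (w.map not)).2.2 := by positivity
  exact le_of_mul_le_mul_left (by linarith) hc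

lemma sbSet_true_cons_subset (w : List Bool) : sbSet (sb (true :: w)) ⊆ Iic 1 := by
  intro x hx
  have hpos := (sb_pos (true :: w)).2
  rw [mem_sbSet_sb] at hx
  have h1 := hx.2
  rw [sb_true_cons] at h1 hpos
  push_cast at h1
  have hc : (0 : ℝ) < (sb (w.map not)).1.2 := by exact_mod_cast hpos
  have hd : (0 : ℝ) ≤ (sb (w.map not)).1.1 := by positivity
  by_contra hlt
  simp only [mem_Iic, not_le] at hlt
  nlinarith

section Stationary

variable {α : ℝ} {ν : Measure ℝ}

lemma IsSternBrocotMeasure.stationary (hα : α ∈ Icc (0 : ℝ) 1) (h : IsSternBrocotMeasure α ν) :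
    ENNReal.ofReal α • ν.map sbUp + ENNReal.ofReal (1 - α) • ν.map sbDown = ν := by
  have : IsProbabilityMeasure ν := h.1
  have hpos := h.ae_pos hα
  have hα' : 0 ≤ 1 - α := by linarith [hα.2]
  have hU : IsProbabilityMeasure (ν.map sbUp) :=
    Measure.isProbabilityMeasure_map measurable_sbUp.aemeasurable
  have hD : IsProbabilityMeasure (ν.map sbDown) :=
    Measure.isProbabilityMeasure_map measurable_sbDown.aemeasurable
  have f1 : IsFiniteMeasure (ENNReal.ofReal α • ν.map sbUp) :=
    Measure.smul_finite _ ENNReal.ofReal_ne_top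
  have f2 : IsFiniteMeasure (ENNReal.ofReal (1 - α) • ν.map sbDown) :=
    Measure.smul_finite _ ENNReal.ofReal_ne_top
  have apply {S : Set ℝ} (hS : MeasurableSet S) :
      (ENNReal.ofReal α • ν.map sbUp + ENNReal.ofReal (1 - α) • ν.map sbDown).real S =
        α * ν.real (sbUp ⁻¹' S) + (1 - α) * ν.real (sbDown ⁻¹' S) := by
    rw [measureReal_add_apply, measureReal_ennreal_smul_apply, measureReal_ennreal_smul_apply,
      map_measureReal_apply measurable_sbUp hS, map_measureReal_apply measurable_sbDown hS,
      ENNReal.toReal_ofReal hα.1, ENNReal.toReal_ofReal hα']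
  have hcongr {S T : Set ℝ} (hST : ∀ x, 0 < x → (x ∈ S ↔ x ∈ T)) : ν.real S = ν.real T := by
    refine measureReal_congr ?_
    filter_upwards [hpos] with x hx
    exact propext (hST x hx)
  have hempty {S : Set ℝ} (hS : ∀ x, 0 < x → x ∉ S) : ν.real S = 0 := by
    rw [hcongr (T := ∅) (fun x hx => by simp [hS x hx]), measureReal_empty]
  refine measure_ext_of_sbSet ?_ (h.real_children hα) ?_ h.2.1
  · intro w
    rw [apply (measurableSet_sbSet_sb w), h.real_sbSet hα]
    match w with
    | [] =>
      have huniv {f : ℝ → ℝ} (hf : ∀ x, 0 < x → 0 < f x) :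
          ν.real (f ⁻¹' sbSet (sb [])) = 1 := by
        rw [hcongr (T := univ) (fun x hx => by simp [sbSet_sb_nil, (hf x hx).le]),
          probReal_univ]
      rw [huniv (fun x hx => one_pos.trans (one_lt_sbUp hx)), huniv (fun x => sbDown_pos)]
      simp [wordMass]
    | false :: w =>
      have eU : ν.real (sbUp ⁻¹' sbSet (sb (false :: w))) = ν.real (sbSet (sb (w.map not))) :=
        hcongr fun x hx => sbUp_mem_false_cons hx
      have eD : ν.real (sbDown ⁻¹' sbSet (sb (false :: w))) = 0 :=
        hempty fun x hx hm => (sbDown_lt_one hx).not_ge (sbSet_false_cons_subset w hm)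
      rw [eU, eD, h.real_sbSet hα, wordMass_map_not]
      simp [wordMass]
    | true :: w =>
      have eD : ν.real (sbDown ⁻¹' sbSet (sb (true :: w))) = ν.real (sbSet (sb (w.map not))) :=
        hcongr fun x hx => sbDown_mem_true_cons hx
      have eU : ν.real (sbUp ⁻¹' sbSet (sb (true :: w))) = 0 :=
        hempty fun x hx hm => (one_lt_sbUp hx).not_ge (sbSet_true_cons_subset w hm)
      rw [eU, eD, h.real_sbSet hα, wordMass_map_not]
      simp [wordMass]
  · rw [← measureReal_eq_zero_iff, apply measurableSet_Iio,
      hempty (S := sbUp ⁻¹' Iio 0) (fun x hx (hm : sbUp x < 0) =>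
        (one_pos.trans (one_lt_sbUp hx)).not_gt hm),
      hempty (S := sbDown ⁻¹' Iio 0) (fun x hx (hm : sbDown x < 0) =>
        (sbDown_pos hx).not_gt hm)]
    simp

lemma IsSternBrocotMeasure.integral_eq (hα : α ∈ Icc (0 : ℝ) 1) (h : IsSternBrocotMeasure α ν)
    {f : ℝ → ℝ} (hf : Measurable f) (hU : Integrable (fun x => f (sbUp x)) ν)
    (hD : Integrable (fun x => f (sbDown x)) ν) :
    ∫ x, f x ∂ν = α * ∫ x, f (sbUp x) ∂ν + (1 - α) * ∫ x, f (sbDown x) ∂ν := by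
  have hα' : 0 ≤ 1 - α := by linarith [hα.2]
  conv_lhs => rw [← h.stationary hα]
  rw [integral_add_measure, integral_smul_measure, integral_smul_measure,
    integral_map measurable_sbUp.aemeasurable hf.aestronglyMeasurable,
    integral_map measurable_sbDown.aemeasurable hf.aestronglyMeasurable,
    ENNReal.toReal_ofReal hα.1, ENNReal.toReal_ofReal hα', smul_eq_mul, smul_eq_mul]
  · refine Integrable.smul_measure ?_ ENNReal.ofReal_ne_top
    exact (integrable_map_measure hf.aestronglyMeasurable measurable_sbUp.aemeasurable).2 hU
  · refine Integrable.smul_measure ?_ ENNReal.ofReal_ne_top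
    exact (integrable_map_measure hf.aestronglyMeasurable measurable_sbDown.aemeasurable).2 hD

end Stationary

lemma integrable_of_integral_min_le {ν : Measure ℝ} [IsFiniteMeasure ν] {g : ℝ → ℝ}
    (hg : Measurable g) (h0 : ∀ x, 0 ≤ g x) {C : ℝ}
    (hC : ∀ M : ℕ, ∫ x, min (g x) M ∂ν ≤ C) : Integrable g ν := by
  refine ⟨hg.aestronglyMeasurable, ?_⟩
  rw [hasFiniteIntegral_iff_ofReal (ae_of_all _ h0)]
  have hlim : Tendsto (fun M : ℕ => ∫⁻ x, ENNReal.ofReal (min (g x) M) ∂ν) atTop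
      (𝓝 (∫⁻ x, ENNReal.ofReal (g x) ∂ν)) := by
    refine lintegral_tendsto_of_tendsto_of_monotone (fun M => by fun_prop)
      (ae_of_all _ fun x M N hMN => ?_) (ae_of_all _ fun x => ?_)
    · refine ENNReal.ofReal_le_ofReal (min_le_min_left _ ?_)
      exact_mod_cast hMN
    · obtain ⟨N, hN⟩ := exists_nat_ge (g x)
      refine tendsto_const_nhds.congr' ?_
      filter_upwards [eventually_ge_atTop N] with M hM
      have : (N : ℝ) ≤ M := by exact_mod_cast hM
      rw [min_eq_left (by linarith)]
  refine lt_of_le_of_lt (le_of_tendsto' hlim fun M => ?_) (ENNReal.ofReal_lt_top (r := C))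
  have h0M (x : ℝ) : 0 ≤ min (g x) M := le_min (h0 x) M.cast_nonneg
  rw [← ofReal_integral_eq_lintegral_ofReal ?_ (ae_of_all _ h0M)]
  · exact ENNReal.ofReal_le_ofReal (hC M)
  · refine Integrable.of_bound (by fun_prop) (M : ℝ) (ae_of_all _ fun x => ?_)
    rw [Real.norm_of_nonneg (h0M x)]
    exact min_le_right _ _

lemma IsSternBrocotMeasure.integrable_log {α : ℝ} {ν : Measure ℝ} (hα : α ∈ Icc (0 : ℝ) 1)
    (h : IsSternBrocotMeasure α ν) : Integrable Real.log ν := by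
  have : IsProbabilityMeasure ν := h.1
  have hpos := h.ae_pos hα
  have hα0 := hα.1
  have hα1 := hα.2
  have hlog2 : (0 : ℝ) ≤ Real.log 2 := Real.log_nonneg (by norm_num)
  have key (M : ℕ) : ∫ x, min (max (Real.log x) 0) M ∂ν ≤ 2 * Real.log 2 ∧
      ∫ x, min (max (-Real.log x) 0) M ∂ν ≤ 2 * Real.log 2 := by
    have hM : (0 : ℝ) ≤ M := M.cast_nonneg
    have hint {f : ℝ → ℝ} (hf : Measurable f) :
        Integrable (fun x => min (max (f x) 0) (M : ℝ)) ν := by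
      refine Integrable.of_bound (by fun_prop) (M : ℝ) (ae_of_all _ fun x => ?_)
      rw [Real.norm_of_nonneg (le_min (le_max_right _ _) hM)]
      exact min_le_right _ _
    have mU := measurable_sbUp
    have mD := measurable_sbDown
    have e1 := h.integral_eq hα (f := fun x => min (max (Real.log x) 0) (M : ℝ)) (by fun_prop)
      (hint (f := fun x => Real.log (sbUp x)) (by fun_prop))
      (hint (f := fun x => Real.log (sbDown x)) (by fun_prop))
    have e2 := h.integral_eq hα (f := fun x => min (max (-Real.log x) 0) (M : ℝ)) (by fun_prop)
      (hint (f := fun x => -Real.log (sbUp x)) (by fun_prop))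
      (hint (f := fun x => -Real.log (sbDown x)) (by fun_prop))
    have z1 : ∫ x, min (max (Real.log (sbDown x)) 0) (M : ℝ) ∂ν = 0 := by
      refine integral_eq_zero_of_ae ?_
      filter_upwards [hpos] with x hx
      have := Real.log_nonpos (sbDown_pos hx).le (sbDown_lt_one hx).le
      simp [max_eq_right this]
    have z2 : ∫ x, min (max (-Real.log (sbUp x)) 0) (M : ℝ) ∂ν = 0 := by
      refine integral_eq_zero_of_ae ?_
      filter_upwards [hpos] with x hx
      have := Real.log_nonneg (one_lt_sbUp hx).le
      simp [max_eq_right (neg_nonpos.2 this)]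
    have hbound {x : ℝ} (hx : 0 < x) : Real.log (1 + x) ≤ Real.log 2 + max (Real.log x) 0 := by
      rcases le_total x 1 with h1 | h1
      · have := Real.log_le_log (by linarith) (show 1 + x ≤ 2 by linarith)
        linarith [le_max_right (Real.log x) 0]
      · have := Real.log_le_log (by linarith) (show 1 + x ≤ 2 * x by linarith)
        rw [Real.log_mul (by norm_num) hx.ne'] at this
        linarith [le_max_left (Real.log x) 0]
    have hmin {u v : ℝ} (huv : u ≤ Real.log 2 + max v 0) :
        min (max u 0) (M : ℝ) ≤ Real.log 2 + min (max v 0) M := by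
      have hv := le_max_right v 0
      rcases le_total (max v 0) (M : ℝ) with hc | hc
      · rw [min_eq_left hc]
        exact (min_le_left _ _).trans (max_le huv (by linarith))
      · rw [min_eq_right hc]
        exact (min_le_right _ _).trans (by linarith)
    have b1 : ∫ x, min (max (Real.log (sbUp x)) 0) (M : ℝ) ∂ν ≤
        Real.log 2 + ∫ x, min (max (-Real.log x) 0) (M : ℝ) ∂ν := by
      have := integral_mono_ae (hint (f := fun x => Real.log (sbUp x)) (by fun_prop))
        ((integrable_const (Real.log 2)).add (hint (f := fun x => -Real.log x) (by fun_prop)))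
        (by
          filter_upwards [hpos] with x hx
          refine hmin ?_
          have := hbound (inv_pos.2 hx)
          rwa [Real.log_inv] at this)
      simpa [integral_add (integrable_const (Real.log 2))
        (hint (f := fun x => -Real.log x) (by fun_prop))] using this
    have b2 : ∫ x, min (max (-Real.log (sbDown x)) 0) (M : ℝ) ∂ν ≤
        Real.log 2 + ∫ x, min (max (Real.log x) 0) (M : ℝ) ∂ν := by
      have := integral_mono_ae (hint (f := fun x => -Real.log (sbDown x)) (by fun_prop))
        ((integrable_const (Real.log 2)).add (hint (f := fun x => Real.log x) (by fun_prop)))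
        (by
          filter_upwards [hpos] with x hx
          refine hmin ?_
          have := hbound hx
          rwa [sbDown, Real.log_inv, neg_neg])
      simpa [integral_add (integrable_const (Real.log 2))
        (hint (f := fun x => Real.log x) (by fun_prop))] using this
    rw [z1, mul_zero, add_zero] at e1
    rw [z2, mul_zero, zero_add] at e2
    set A := ∫ x, min (max (-Real.log x) 0) (M : ℝ) ∂ν
    set B := ∫ x, min (max (Real.log x) 0) (M : ℝ) ∂ν
    have hB : B ≤ α * (Real.log 2 + A) := e1.trans_le (mul_le_mul_of_nonneg_left b1 hα0)
    have hA : A ≤ (1 - α) * (Real.log 2 + B) :=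
      e2.trans_le (mul_le_mul_of_nonneg_left b2 (by linarith))
    have hq : α * (1 - α) ≤ 1 / 4 := by nlinarith [sq_nonneg (2 * α - 1)]
    have hA0 : 0 ≤ A := integral_nonneg fun x => le_min (le_max_right _ _) hM
    have hB0 : 0 ≤ B := integral_nonneg fun x => le_min (le_max_right _ _) hM
    have hα' : 0 ≤ 1 - α := by linarith
    have h1 := mul_le_mul_of_nonneg_left hA hα0
    have h2 := mul_le_mul_of_nonneg_left hB hα'
    have h3 := mul_le_mul_of_nonneg_right hq (add_nonneg hlog2 hA0)
    have h4 := mul_le_mul_of_nonneg_right hq (add_nonneg hlog2 hB0)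
    constructor <;> nlinarith
  have i1 : Integrable (fun x => max (Real.log x) 0) ν :=
    integrable_of_integral_min_le (by fun_prop) (fun x => le_max_right _ _) fun M => (key M).1
  have i2 : Integrable (fun x => max (-Real.log x) 0) ν :=
    integrable_of_integral_min_le (by fun_prop) (fun x => le_max_right _ _) fun M => (key M).2
  refine (i1.sub i2).congr (ae_of_all _ fun x => ?_)
  rcases le_total (Real.log x) 0 with hx | hx <;> simp [hx]

/-- The transition operator of the random walk whose stationary measure is `ν_α`. -/
def sbStep (α : ℝ) (f : ℝ → ℝ) (x : ℝ) : ℝ := α * f (sbUp x) + (1 - α) * f (sbDown x)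

/-- `f` is measurable and, on `(0, ∞)`, `K`-Lipschitz as a function of `log x`. -/
def LogLipschitz (K : ℝ) (f : ℝ → ℝ) : Prop :=
  Measurable f ∧ ∀ x y, 0 < x → 0 < y → |f x - f y| ≤ K * |Real.log x - Real.log y|

lemma logLipschitz_log : LogLipschitz 1 Real.log :=
  ⟨Real.measurable_log, fun x y _ _ => by simp⟩

lemma LogLipschitz.add {K L : ℝ} {f g : ℝ → ℝ} (hf : LogLipschitz K f) (hg : LogLipschitz L g) :
    LogLipschitz (K + L) (fun x => f x + g x) := by
  refine ⟨hf.1.add hg.1, fun x y hx hy => ?_⟩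
  have h1 := hf.2 x y hx hy
  have h2 := hg.2 x y hx hy
  have h3 := abs_add_le (f x - f y) (g x - g y)
  rw [show f x + g x - (f y + g y) = f x - f y + (g x - g y) by ring]
  linarith

lemma log_sbUp_sub {x y : ℝ} (hx : 0 < x) (hy : 0 < y) :
    Real.log (sbUp x) - Real.log (sbUp y) =
      Real.log (1 + x) - Real.log x - (Real.log (1 + y) - Real.log y) := by
  have h {z : ℝ} (hz : 0 < z) : Real.log (sbUp z) = Real.log (1 + z) - Real.log z := by
    rw [← Real.log_div (by positivity) hz.ne']
    congr 1
    unfold sbUp; field_simp; ring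
  rw [h hx, h hy]

lemma log_sbDown (x : ℝ) : Real.log (sbDown x) = -Real.log (1 + x) := Real.log_inv _

lemma LogLipschitz.step {α K : ℝ} (hα : α ∈ Icc (0 : ℝ) 1) {f : ℝ → ℝ}
    (hf : LogLipschitz K f) : LogLipschitz (max α (1 - α) * K) (sbStep α f) := by
  have hα' : 0 ≤ 1 - α := by linarith [hα.2]
  refine ⟨((hf.1.comp measurable_sbUp).const_mul _).add
    ((hf.1.comp measurable_sbDown).const_mul _), ?_⟩
  have main : ∀ x y, 0 < x → x ≤ y →
      |sbStep α f x - sbStep α f y| ≤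
        max α (1 - α) * K * |Real.log x - Real.log y| := by
    intro x y hx hxy
    have hy := hx.trans_le hxy
    have hU := hf.2 (sbUp x) (sbUp y) (one_pos.trans (one_lt_sbUp hx))
      (one_pos.trans (one_lt_sbUp hy))
    have hD := hf.2 (sbDown x) (sbDown y) (sbDown_pos hx) (sbDown_pos hy)
    have hU0 : 0 ≤ Real.log (sbUp x) - Real.log (sbUp y) :=
      sub_nonneg.2 (Real.log_le_log (one_pos.trans (one_lt_sbUp hy)) (antitoneOn_sbUp hx hy hxy))
    have hD0 : 0 ≤ Real.log (sbDown x) - Real.log (sbDown y) :=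
      sub_nonneg.2 (Real.log_le_log (sbDown_pos hy) (antitoneOn_sbDown hx hy hxy))
    have hl := Real.log_le_log hx hxy
    have hsum : Real.log y - Real.log x = (Real.log (sbUp x) - Real.log (sbUp y)) +
        (Real.log (sbDown x) - Real.log (sbDown y)) := by
      rw [log_sbUp_sub hx hy, log_sbDown, log_sbDown]; ring
    rw [abs_of_nonneg hU0] at hU
    rw [abs_of_nonneg hD0] at hD
    rw [abs_sub_comm (Real.log x), abs_of_nonneg (sub_nonneg.2 hl), hsum,
      show sbStep α f x - sbStep α f y =
        α * (f (sbUp x) - f (sbUp y)) + (1 - α) * (f (sbDown x) - f (sbDown y)) by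
        unfold sbStep; ring]
    refine (abs_add_le _ _).trans ?_
    rw [abs_mul, abs_mul, abs_of_nonneg hα.1, abs_of_nonneg hα', mul_add]
    gcongr ?_ + ?_
    · rw [mul_assoc]
      exact mul_le_mul (le_max_left _ _) hU (abs_nonneg _) (hα.1.trans (le_max_left _ _))
    · rw [mul_assoc]
      exact mul_le_mul (le_max_right _ _) hD (abs_nonneg _) (hα.1.trans (le_max_left _ _))
  intro x y hx hy
  rcases le_total x y with hxy | hxy
  · exact main x y hx hxy
  · rw [abs_sub_comm, abs_sub_comm (Real.log x)]
    exact main y x hy hxy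

lemma LogLipschitz.iterate_sbStep {α : ℝ} (hα : α ∈ Icc (0 : ℝ) 1) (n : ℕ) :
    LogLipschitz (max α (1 - α) ^ n) ((sbStep α)^[n] Real.log) := by
  induction n with
  | zero => simpa using logLipschitz_log
  | succ n ih =>
    rw [Function.iterate_succ_apply', pow_succ']
    exact ih.step hα

lemma sbStep_add (α : ℝ) (f g : ℝ → ℝ) :
    sbStep α (fun x => f x + g x) = fun x => sbStep α f x + sbStep α g x := by
  funext x; unfold sbStep; ring

lemma MonotoneOn.sbStep {α : ℝ} (hα : α ∈ Icc (0 : ℝ) 1) {f : ℝ → ℝ}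
    (hf : MonotoneOn f (Ioi 0)) : AntitoneOn (sbStep α f) (Ioi 0) := by
  have hα' : 0 ≤ 1 - α := by linarith [hα.2]
  intro x hx y hy hxy
  exact add_le_add
    (mul_le_mul_of_nonneg_left (hf (one_pos.trans (one_lt_sbUp hy))
      (one_pos.trans (one_lt_sbUp hx)) (antitoneOn_sbUp hx hy hxy)) hα.1)
    (mul_le_mul_of_nonneg_left (hf (sbDown_pos hy) (sbDown_pos hx)
      (antitoneOn_sbDown hx hy hxy)) hα')

lemma AntitoneOn.sbStep {α : ℝ} (hα : α ∈ Icc (0 : ℝ) 1) {f : ℝ → ℝ}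
    (hf : AntitoneOn f (Ioi 0)) : MonotoneOn (sbStep α f) (Ioi 0) := by
  have hα' : 0 ≤ 1 - α := by linarith [hα.2]
  intro x hx y hy hxy
  exact add_le_add
    (mul_le_mul_of_nonneg_left (hf (one_pos.trans (one_lt_sbUp hy))
      (one_pos.trans (one_lt_sbUp hx)) (antitoneOn_sbUp hx hy hxy)) hα.1)
    (mul_le_mul_of_nonneg_left (hf (sbDown_pos hy) (sbDown_pos hx)
      (antitoneOn_sbDown hx hy hxy)) hα')

lemma strictMonoOn_log_add_sbStep_log {α : ℝ} (hα : α ∈ Ioo (0 : ℝ) 1) :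
    StrictMonoOn (fun x => Real.log x + sbStep α Real.log x) (Ioi 0) := by
  intro x hx y hy hxy
  have hx' : 0 < x := hx
  have hy' : 0 < y := hy
  have h1 := log_sbUp_sub hx' hy'
  have h2 : Real.log x < Real.log y := Real.log_lt_log hx' hxy
  have h3 : Real.log (1 + x) < Real.log (1 + y) := Real.log_lt_log (by linarith) (by linarith)
  have h4 : 0 < Real.log (sbUp x) - Real.log (sbUp y) :=
    sub_pos.2 (Real.log_lt_log (one_pos.trans (one_lt_sbUp hy'))
      (by have := inv_strictAnti₀ hx' hxy; unfold sbUp; linarith))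
  simp only [sbStep, log_sbDown]
  have h5 := mul_pos (sub_pos.2 hα.2) h4
  have h6 := mul_pos hα.1 (sub_pos.2 h3)
  linarith

lemma monotoneOn_iterate_add_iterate {α : ℝ} (hα : α ∈ Ioo (0 : ℝ) 1) (k : ℕ) :
    MonotoneOn (fun x => (sbStep α)^[2 * k] Real.log x + (sbStep α)^[2 * k + 1] Real.log x)
      (Ioi 0) := by
  have hα' : α ∈ Icc (0 : ℝ) 1 := Ioo_subset_Icc_self hα
  induction k with
  | zero => exact (strictMonoOn_log_add_sbStep_log hα).monotoneOn
  | succ k ih =>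
    have h := (ih.sbStep hα').sbStep hα'
    rw [sbStep_add, sbStep_add] at h
    simpa only [Nat.mul_succ, ← Function.iterate_succ_apply' (sbStep α)] using h

section Compare

variable {α β K : ℝ} {ν : Measure ℝ} {f : ℝ → ℝ}

lemma LogLipschitz.integrable (hβ : β ∈ Icc (0 : ℝ) 1) (h : IsSternBrocotMeasure β ν)
    (hf : LogLipschitz K f) : Integrable f ν := by
  have : IsProbabilityMeasure ν := h.1
  refine Integrable.mono' (((h.integrable_log hβ).abs.const_mul K).add (integrable_const |f 1|))
    hf.1.aestronglyMeasurable ?_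
  filter_upwards [h.ae_pos hβ] with x hx
  have h1 := hf.2 x 1 hx one_pos
  have h2 := abs_add_le (f x - f 1) (f 1)
  rw [sub_add_cancel] at h2
  rw [Real.log_one, sub_zero] at h1
  simp only [Real.norm_eq_abs, Pi.add_apply]
  linarith

lemma LogLipschitz.comp_up (hf : LogLipschitz K f) :
    LogLipschitz K (fun x => f (sbUp x)) := by
  have h := hf.step (α := 1) (by simp)
  have e : sbStep 1 f = fun x => f (sbUp x) := by funext x; simp [sbStep]
  rw [e] at h
  simpa using h

lemma LogLipschitz.comp_down (hf : LogLipschitz K f) :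
    LogLipschitz K (fun x => f (sbDown x)) := by
  have h := hf.step (α := 0) (by simp)
  have e : sbStep 0 f = fun x => f (sbDown x) := by funext x; simp [sbStep]
  rw [e] at h
  simpa using h

lemma integral_sbStep (hβ : β ∈ Icc (0 : ℝ) 1) (h : IsSternBrocotMeasure β ν)
    (hf : LogLipschitz K f) (α : ℝ) :
    ∫ x, f x ∂ν - ∫ x, sbStep α f x ∂ν =
      (β - α) * ∫ x, (f (sbUp x) - f (sbDown x)) ∂ν := by
  have iU := hf.comp_up.integrable hβ h
  have iD := hf.comp_down.integrable hβ h
  rw [h.integral_eq hβ hf.1 iU iD, integral_sub iU iD]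
  unfold sbStep
  rw [integral_add (iU.const_mul _) (iD.const_mul _), integral_const_mul, integral_const_mul]
  ring

lemma sbDown_lt_sbUp {x : ℝ} (hx : 0 < x) : sbDown x < sbUp x :=
  (sbDown_lt_one hx).trans (one_lt_sbUp hx)

lemma integral_iterate_add_two (hα : α ∈ Icc (0 : ℝ) 1) (hβ : β ∈ Icc (0 : ℝ) 1)
    (h : IsSternBrocotMeasure β ν) (n : ℕ) :
    ∫ x, (sbStep α)^[n] Real.log x ∂ν - ∫ x, (sbStep α)^[n + 2] Real.log x ∂ν =
      (β - α) * ∫ x,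
        (((sbStep α)^[n] Real.log (sbUp x) + (sbStep α)^[n + 1] Real.log (sbUp x)) -
        ((sbStep α)^[n] Real.log (sbDown x) + (sbStep α)^[n + 1] Real.log (sbDown x))) ∂ν := by
  have hl (m : ℕ) := LogLipschitz.iterate_sbStep hα m
  have hi (m : ℕ) := (hl m).integrable hβ h
  have key := integral_sbStep hβ h ((hl n).add (hl (n + 1))) α
  rw [← key, sbStep_add, ← Function.iterate_succ_apply' (sbStep α),
    ← Function.iterate_succ_apply' (sbStep α), integral_add (hi _) (hi _),
    integral_add (hi _) (hi _)]
  ring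

lemma tendsto_integral_iterate_sub (hα : α ∈ Ioo (0 : ℝ) 1) (hβ : β ∈ Icc (0 : ℝ) 1)
    (h : IsSternBrocotMeasure β ν) :
    Tendsto (fun n => ∫ x, (sbStep α)^[n] Real.log x ∂ν - (sbStep α)^[n] Real.log 1)
      atTop (𝓝 0) := by
  have : IsProbabilityMeasure ν := h.1
  have hα' : α ∈ Icc (0 : ℝ) 1 := Ioo_subset_Icc_self hα
  have hc0 : 0 ≤ max α (1 - α) := hα'.1.trans (le_max_left _ _)
  have hc1 : max α (1 - α) < 1 := max_lt hα.2 (by linarith [hα.1])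
  have hlim : Tendsto (fun n : ℕ => max α (1 - α) ^ n * ∫ x, |Real.log x| ∂ν) atTop (𝓝 0) := by
    simpa using (tendsto_pow_atTop_nhds_zero_of_lt_one hc0 hc1).mul_const (∫ x, |Real.log x| ∂ν)
  refine squeeze_zero_norm (fun n => ?_) hlim
  have hl := LogLipschitz.iterate_sbStep hα' n
  have hi := hl.integrable hβ h
  have e : ∫ x, (sbStep α)^[n] Real.log x ∂ν - (sbStep α)^[n] Real.log 1 =
      ∫ x, ((sbStep α)^[n] Real.log x - (sbStep α)^[n] Real.log 1) ∂ν := by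
    rw [integral_sub hi (integrable_const _)]; simp
  rw [e, ← integral_const_mul]
  refine norm_integral_le_of_norm_le ((h.integrable_log hβ).abs.const_mul _) ?_
  filter_upwards [h.ae_pos hβ] with x hx
  simpa using hl.2 x 1 hx one_pos

end Compare

/-- The integral of `log` against `ν_α` is strictly increasing in `α`. -/
lemma integral_log_lt {α β : ℝ} {μ ν : Measure ℝ} (hα : α ∈ Ioo (0 : ℝ) 1)
    (hβ : β ∈ Icc (0 : ℝ) 1) (hαβ : α < β) (hμ : IsSternBrocotMeasure α μ)
    (hν : IsSternBrocotMeasure β ν) :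
    ∫ x, Real.log x ∂μ < ∫ x, Real.log x ∂ν := by
  have : IsProbabilityMeasure ν := hν.1
  have hα' : α ∈ Icc (0 : ℝ) 1 := Ioo_subset_Icc_self hα
  have hl (m : ℕ) := LogLipschitz.iterate_sbStep hα' m
  have hstat (n : ℕ) : ∫ x, (sbStep α)^[n] Real.log x ∂μ = ∫ x, Real.log x ∂μ := by
    induction n with
    | zero => rfl
    | succ n ih =>
      have := integral_sbStep hα' hμ (hl n) α
      rw [sub_self, zero_mul, sub_eq_zero] at this
      rw [Function.iterate_succ_apply', ← this, ih]
  have hlim : Tendsto (fun n => ∫ x, (sbStep α)^[n] Real.log x ∂ν) atTop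
      (𝓝 (∫ x, Real.log x ∂μ)) := by
    have h1 := (tendsto_integral_iterate_sub hα hβ hν).sub
      (tendsto_integral_iterate_sub hα hα' hμ)
    have h2 := h1.add_const (∫ x, Real.log x ∂μ)
    simp only [hstat, sub_zero, zero_add] at h2
    refine h2.congr fun n => ?_
    ring
  have hanti : Antitone (fun k : ℕ => ∫ x, (sbStep α)^[2 * k] Real.log x ∂ν) := by
    refine antitone_nat_of_succ_le fun k => ?_
    rw [← sub_nonneg, Nat.mul_succ, integral_iterate_add_two hα' hβ hν]
    refine mul_nonneg (sub_pos.2 hαβ).le (integral_nonneg_of_ae ?_)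
    filter_upwards [hν.ae_pos hβ] with x hx
    exact sub_nonneg.2 (monotoneOn_iterate_add_iterate hα k (sbDown_pos hx)
      (one_pos.trans (one_lt_sbUp hx)) (sbDown_lt_sbUp hx).le)
  have hle : ∫ x, Real.log x ∂μ ≤ ∫ x, (sbStep α)^[2] Real.log x ∂ν :=
    hanti.le_of_tendsto (hlim.comp (tendsto_id.const_mul_atTop' two_pos)) 1
  refine hle.trans_lt (sub_pos.1 ?_)
  have hdiff := integral_iterate_add_two hα' hβ hν 0
  simp only [zero_add, Function.iterate_zero, id, Function.iterate_one] at hdiff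
  rw [hdiff]
  refine mul_pos (sub_pos.2 hαβ) ?_
  have hpos : ∀ᵐ x ∂ν, 0 < Real.log (sbUp x) + sbStep α Real.log (sbUp x) -
      (Real.log (sbDown x) + sbStep α Real.log (sbDown x)) := by
    filter_upwards [hν.ae_pos hβ] with x hx
    exact sub_pos.2 (strictMonoOn_log_add_sbStep_log hα (sbDown_pos hx)
      (one_pos.trans (one_lt_sbUp hx)) (sbDown_lt_sbUp hx))
  have hu := (hl 0).add (hl 1)
  have hint := ((hu.comp_up).integrable hβ hν).sub ((hu.comp_down).integrable hβ hν)
  rw [integral_pos_iff_support_of_nonneg_ae (hpos.mono fun x hx => hx.le) hint]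
  refine lt_of_lt_of_eq one_pos ?_
  rw [← measure_univ (μ := ν)]
  refine (measure_congr ?_).symm
  filter_upwards [hpos] with x hx
  exact eq_true hx.ne'

/-- The parameter `α(p)` of the Stern-Brocot measure. -/
def sbParam (p : ℝ) : ℝ := (3 * p - 2 + Real.sqrt (5 * p ^ 2 - 8 * p + 4)) / (2 * p)

lemma sbParam_mem {p : ℝ} (hp : p ∈ Ioc (0 : ℝ) 1) : sbParam p ∈ Ioc (1 / 2 : ℝ) 1 := by
  obtain ⟨h0, h1⟩ := hp
  have hs1 : 2 - 2 * p < Real.sqrt (5 * p ^ 2 - 8 * p + 4) :=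
    Real.lt_sqrt_of_sq_lt (by nlinarith)
  have hs2 : Real.sqrt (5 * p ^ 2 - 8 * p + 4) ≤ 2 - p :=
    Real.sqrt_le_iff.2 ⟨by linarith, by nlinarith⟩
  unfold sbParam
  constructor
  · rw [lt_div_iff₀ (by linarith)]; linarith
  · rw [div_le_iff₀ (by linarith)]; linarith

lemma sbParam_eq {p : ℝ} (hp : 0 < p) :
    p * (3 * sbParam p - 1 - sbParam p ^ 2) = 2 * sbParam p - 1 := by
  have hs := Real.sq_sqrt (show 0 ≤ 5 * p ^ 2 - 8 * p + 4 by nlinarith [sq_nonneg (5 * p - 4)])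
  unfold sbParam
  set s := Real.sqrt (5 * p ^ 2 - 8 * p + 4)
  field_simp
  linear_combination (-1 : ℝ) * hs

lemma strictMonoOn_sbParam : StrictMonoOn sbParam (Ioc 0 1) := by
  intro p hp q hq hpq
  obtain ⟨a1, a2⟩ := sbParam_mem hp
  obtain ⟨b1, b2⟩ := sbParam_mem hq
  have ha := sbParam_eq hp.1
  have hb := sbParam_eq hq.1
  set a := sbParam p
  set b := sbParam q
  by_contra! hle
  have hda : 0 < 3 * a - 1 - a ^ 2 := by nlinarith
  have hdb : 0 < 3 * b - 1 - b ^ 2 := by nlinarith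
  have h1 : (q - p) * ((3 * a - 1 - a ^ 2) * (3 * b - 1 - b ^ 2)) =
      (b - a) * ((1 - a) * (1 - b) + a * b) := by
    linear_combination (3 * a - 1 - a ^ 2) * hb - (3 * b - 1 - b ^ 2) * ha
  have h2 : 0 < (q - p) * ((3 * a - 1 - a ^ 2) * (3 * b - 1 - b ^ 2)) :=
    mul_pos (sub_pos.2 hpq) (mul_pos hda hdb)
  have h3 : 0 ≤ (1 - a) * (1 - b) + a * b := by
    have := mul_nonneg (sub_nonneg.2 a2) (sub_nonneg.2 b2)
    nlinarith
  have h4 := mul_nonneg (sub_nonneg.2 hle) h3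
  linarith

/-- `p ↦ γ_p = ∫ log x dν_{α(p)}(x)`, with `α(p) = (3p - 2 + √(5p² - 8p + 4))/(2p)`, is strictly
increasing on `(0,1]`; consequently `α ↦ ∫ log x dν_α(x)` is strictly increasing on `(1/2,1]`. -/
theorem gamma_strictMonoOn
    (ν : ℝ → Measure ℝ) (hν : ∀ α ∈ Set.Icc (0 : ℝ) 1, IsSternBrocotMeasure α (ν α)) :
    StrictMonoOn (fun p : ℝ =>
        ∫ x, Real.log x ∂(ν ((3 * p - 2 + Real.sqrt (5 * p ^ 2 - 8 * p + 4)) / (2 * p))))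
      (Set.Ioc 0 1) ∧
    StrictMonoOn (fun α : ℝ => ∫ x, Real.log x ∂(ν α)) (Set.Ioc (1 / 2) 1) := by
  have hmono : StrictMonoOn (fun α : ℝ => ∫ x, Real.log x ∂(ν α)) (Set.Ioc (1 / 2) 1) := by
    intro α hα β hβ hαβ
    have hα' : α ∈ Ioo (0 : ℝ) 1 := ⟨by linarith [hα.1], hαβ.trans_le hβ.2⟩
    have hβ' : β ∈ Icc (0 : ℝ) 1 := ⟨by linarith [hβ.1], hβ.2⟩
    exact integral_log_lt hα' hβ' hαβ (hν α (Ioo_subset_Icc_self hα')) (hν β hβ')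
  exact ⟨hmono.comp strictMonoOn_sbParam fun p => sbParam_mem, hmono⟩
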